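/- Let p be a prime, s ≥ 2 an integer, q = p^s, and k an algebraic closure of F_p. Let G(x,y) = x y^p + (x−1) y and let P ∈ F_q[x] satisfy 2 ≤ deg P ≤ q/p − 1. Write G(x, y+P(x)) = Σ c_{ij} x^i y^j and let H(x,y,z) = Σ c_{ij} x^i y^j z^{q−i−j} be its degree-q homogenization. Define the homogeneous degree-q maps F̃₁, F̃₂ : k³ → k³ by F̃₁(x,y,z) = (x^q, y^q + z^{q−p−1} x y^p + z^{q−2}(x−z) y, z^q) and F̃₂(x,y,z) = (x^q, y^q + H(x,y,z), z^q) (lifts of the extensions of f₁(x,y) = (x^q, y^q+G(x,y)) and f₂(x,y) = (x^q, y^q+G(x,y+P(x))) to endomorphisms of P²_k). Then there exist no M ∈ GL₃(k) and c ∈ k^× such that M·F̃₁(v) = c·F̃₂(M·v) for all v ∈ k³; that is, f₁ and f₂ are not conjugate by any linear automorphism of P²_k, even though they are conjugate by the polynomial automorphism (x,y) ↦ (x, y−P(x)) of A²_k. In particular, the analogue of the main theorem fails in characteristic p. -/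

import Mathlib

open MvPolynomial Polynomial Matrix

/-- The polynomial `G(x,y) = x y^p + (x-1) y` of Section 7. -/
noncomputable def sectionSevenG (p : ℕ) [Fact p.Prime] :
    MvPolynomial (Fin 2) (AlgebraicClosure (ZMod p)) :=
  X 0 * X 1 ^ p + (X 0 - 1) * X 1

/-- The shifted polynomial `G(x, y + P(x))`. -/
noncomputable def sectionSevenGs (p : ℕ) [Fact p.Prime]
    (P : Polynomial (AlgebraicClosure (ZMod p))) :
    MvPolynomial (Fin 2) (AlgebraicClosure (ZMod p)) :=
  aeval ![X 0, X 1 + Polynomial.aeval (X 0) P] (sectionSevenG p)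

/-- The homogenizing sum of `F` is `Z ^ q * F (X / Z, Y / Z)` wherever `Z ≠ 0`. -/
lemma sum_homogenize_eq {K : Type*} [Field K] {q : ℕ} (F : MvPolynomial (Fin 2) K)
    (hF : F.totalDegree ≤ q) (x y : K) {z : K} (hz : z ≠ 0) :
    ∑ m ∈ F.support, MvPolynomial.coeff m F * x ^ (m 0) * y ^ (m 1) * z ^ (q - m 0 - m 1) =
      z ^ q * MvPolynomial.eval ![x / z, y / z] F := by
  rw [MvPolynomial.eval_eq', Finset.mul_sum]
  refine Finset.sum_congr rfl fun m hm => ?_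
  have h : m 0 + m 1 ≤ q := by
    have := (MvPolynomial.le_totalDegree hm).trans hF
    rwa [Finsupp.sum_fintype _ _ (fun _ => rfl), Fin.sum_univ_two] at this
  obtain ⟨r, hr⟩ := Nat.exists_eq_add_of_le h
  have hr2 : q - m 0 - m 1 = r := by omega
  rw [hr2, hr, Fin.prod_univ_two]
  simp only [Matrix.cons_val_zero, Matrix.cons_val_one, div_pow, pow_add]
  field_simp

lemma eval_sectionSevenGs (p : ℕ) [Fact p.Prime] (P : Polynomial (AlgebraicClosure (ZMod p)))
    (x y : AlgebraicClosure (ZMod p)) :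
    MvPolynomial.eval ![x, y] (sectionSevenGs p P) =
      x * (y + P.eval x) ^ p + (x - 1) * (y + P.eval x) := by
  have h : MvPolynomial.eval ![x, y] (Polynomial.aeval (MvPolynomial.X 0) P) = P.eval x := by
    rw [Polynomial.aeval_def, Polynomial.hom_eval₂, Polynomial.eval]
    congr 1
    · ext a; simp
    · simp
  simp [sectionSevenGs, sectionSevenG, h]

lemma totalDegree_aeval_X_le {K σ : Type*} [Field K] (P : Polynomial K) (i : σ) :
    (Polynomial.aeval (MvPolynomial.X i : MvPolynomial σ K) P).totalDegree ≤ P.natDegree := by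
  rw [Polynomial.aeval_eq_sum_range]
  refine MvPolynomial.totalDegree_finsetSum_le fun n hn => ?_
  refine (MvPolynomial.totalDegree_smul_le _ _).trans ?_
  rw [MvPolynomial.totalDegree_X_pow]
  exact Nat.lt_succ_iff.mp (Finset.mem_range.mp hn)

lemma totalDegree_sectionSevenGs_le (p : ℕ) [Fact p.Prime]
    (P : Polynomial (AlgebraicClosure (ZMod p))) (hP : 1 ≤ P.natDegree) :
    (sectionSevenGs p P).totalDegree ≤ 1 + p * P.natDegree := by
  have hp : 1 ≤ p := (Fact.out : p.Prime).one_le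
  have hY : (MvPolynomial.X 1 + Polynomial.aeval (MvPolynomial.X 0) P :
      MvPolynomial (Fin 2) (AlgebraicClosure (ZMod p))).totalDegree ≤ P.natDegree :=
    (MvPolynomial.totalDegree_add _ _).trans
      (max_le (by rwa [MvPolynomial.totalDegree_X]) (totalDegree_aeval_X_le P 0))
  have hX : (MvPolynomial.X 0 : MvPolynomial (Fin 2) (AlgebraicClosure (ZMod p))).totalDegree ≤ 1 :=
    (MvPolynomial.totalDegree_X _).le
  have hX1 : (MvPolynomial.X 0 - 1 :
      MvPolynomial (Fin 2) (AlgebraicClosure (ZMod p))).totalDegree ≤ 1 :=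
    (MvPolynomial.totalDegree_sub _ _).trans (max_le hX (by simp))
  simp only [sectionSevenGs, sectionSevenG, map_add, map_mul, map_pow, map_sub, map_one,
    MvPolynomial.aeval_X, Matrix.cons_val_zero, Matrix.cons_val_one]
  refine (MvPolynomial.totalDegree_add _ _).trans (max_le ?_ ?_)
  · exact (MvPolynomial.totalDegree_mul _ _).trans (add_le_add hX
      ((MvPolynomial.totalDegree_pow _ _).trans (Nat.mul_le_mul_left p hY)))
  · exact (MvPolynomial.totalDegree_mul _ _).trans (add_le_add hX1
      (hY.trans (Nat.le_mul_of_pos_left _ hp)))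

/-- A polynomial function `a t ^ q + b t ^ p + c t + d` with `1 < p < q` that vanishes identically
on an infinite field has vanishing lower coefficients. -/
lemma coeffs_eq_zero_of_forall_eval {K : Type*} [Field K] [Infinite K] {p q : ℕ} (hp : 1 < p)
    (hpq : p < q) {a b c d : K} (h : ∀ t : K, a * t ^ q + b * t ^ p + c * t + d = 0) :
    b = 0 ∧ c = 0 ∧ d = 0 := by
  have h0 : (Polynomial.C a * Polynomial.X ^ q + Polynomial.C b * Polynomial.X ^ p +
      Polynomial.C c * Polynomial.X + Polynomial.C d : Polynomial K) = 0 :=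
    Polynomial.funext fun t => by simpa using h t
  have hc (n : ℕ) := congrArg (fun f : Polynomial K => f.coeff n) h0
  simp only [Polynomial.coeff_add, Polynomial.coeff_C_mul, Polynomial.coeff_X_pow,
    Polynomial.coeff_X, Polynomial.coeff_C, Polynomial.coeff_zero] at hc
  have hb := hc p
  have hc1 := hc 1
  have hd := hc 0
  rw [if_neg (by omega), if_pos rfl, if_neg (by omega), if_neg (by omega)] at hb
  rw [if_neg (by omega), if_neg (by omega), if_pos rfl, if_neg (by omega)] at hc1
  rw [if_neg (by omega), if_neg (by omega), if_neg (by omega), if_pos rfl] at hd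
  exact ⟨by simpa using hb, by simpa using hc1, by simpa using hd⟩

lemma exists_ne_zero_pow_ne_one {K : Type*} [Field K] [Infinite K] {n : ℕ} (hn : 0 < n) :
    ∃ x : K, x ≠ 0 ∧ x ^ n ≠ 1 := by
  by_contra! h
  have h0 : (Polynomial.X * (Polynomial.X ^ n - 1) : Polynomial K) = 0 :=
    Polynomial.funext fun t => by
      by_cases ht : t = 0
      · simp [ht]
      · simp [h t ht]
  rcases mul_eq_zero.mp h0 with h1 | h1
  · exact Polynomial.X_ne_zero h1
  · exact Polynomial.X_pow_sub_C_ne_zero hn (1 : K) (by simpa using h1)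

/-- If `2 ≤ deg P` and `1 + p deg P < q`, then `x R(x) ^ p + (x - 1) R(x)`, for `R` differing from
`P` by an affine function, is never of the form `α x ^ q + β`. -/
lemma not_forall_eq_pow_add_const {K : Type*} [Field K] [Infinite K] {p q : ℕ} (hp : 1 < p)
    (P : Polynomial K) (hP2 : 2 ≤ P.natDegree) (hPq : 1 + p * P.natDegree < q) (e f α β : K) :
    ¬ ∀ x : K, x * (e * x + f + P.eval x) ^ p + (x - 1) * (e * x + f + P.eval x) =
      α * x ^ q + β := by
  intro h
  set R : Polynomial K := Polynomial.C e * Polynomial.X + Polynomial.C f + P with hR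
  have hRd : R.natDegree = P.natDegree := by
    rw [hR]
    exact Polynomial.natDegree_add_eq_right_of_natDegree_lt
      (Polynomial.natDegree_linear_le.trans_lt (by omega))
  have hR0 : R ≠ 0 := by
    rintro h0
    rw [h0, Polynomial.natDegree_zero] at hRd
    omega
  have hpoly : Polynomial.X * R ^ p + (Polynomial.X - Polynomial.C 1) * R =
      Polynomial.C α * Polynomial.X ^ q + Polynomial.C β :=
    Polynomial.funext fun x => by simpa [hR] using h x
  have hdlt : P.natDegree + 1 < p * P.natDegree + 1 := by nlinarith
  have hc := congrArg (fun F : Polynomial K => F.coeff (p * P.natDegree + 1)) hpoly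
  simp only [Polynomial.coeff_add, Polynomial.coeff_X_mul, Polynomial.coeff_C_mul,
    Polynomial.coeff_X_pow, Polynomial.coeff_C] at hc
  rw [if_neg (by omega), if_neg (by omega), ← hRd, Polynomial.coeff_pow_mul_natDegree,
    Polynomial.coeff_eq_zero_of_natDegree_lt (p := (Polynomial.X - Polynomial.C 1) * R)] at hc
  · simp [hR0] at hc
  · refine Polynomial.natDegree_mul_le.trans_lt ?_
    rw [Polynomial.natDegree_X_sub_C, hRd]
    omega

/-- The conjugacy equation forces the second column of the matrix to vanish in any row whose
component of the target map is the `q`-th power map. -/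
lemma entry_eq_zero_of_row {K : Type*} [Field K] [Infinite K] {p s q : ℕ} [Fact p.Prime] [CharP K p]
    (hq : q = p ^ s) (hpq : p < q) {c a b d : K}
    (h : ∀ x y z : K, a * x ^ q +
      b * (y ^ q + z ^ (q - p - 1) * x * y ^ p + z ^ (q - 2) * (x - z) * y) + d * z ^ q =
        c * (a * x + b * y + d * z) ^ q) : b = 0 := by
  refine (coeffs_eq_zero_of_forall_eval (a := b - c * b ^ q) (b := b) (c := 0)
    (d := a + d - c * (a ^ q + d ^ q)) (Fact.out : p.Prime).one_lt hpq fun t => ?_).1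
  have h1 := h 1 t 1
  rw [hq, add_pow_char_pow, add_pow_char_pow, ← hq] at h1
  simp only [mul_pow, one_pow, mul_one, one_mul, sub_self, zero_mul, add_zero] at h1
  linear_combination h1

/-- Section 7 (conclusion): in characteristic `p`, with `q = p^s`, `s ≥ 2`, the maps
`f₁(x,y) = (x^q, y^q + G(x,y))` and `f₂(x,y) = (x^q, y^q + G(x, y+P(x)))`, with
homogeneous degree-`q` lifts `F̃₁(x,y,z) = (x^q, y^q + z^{q-p-1}xy^p + z^{q-2}(x-z)y, z^q)`
and `F̃₂(x,y,z) = (x^q, y^q + H(x,y,z), z^q)` (`H` the degree-`q` homogenization of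
`G(x,y+P(x))`), are *not* conjugate by any linear automorphism of `ℙ²`: the analogue of
the main theorem fails in characteristic `p`. -/
theorem char_p_no_linear_conjugacy (p s q : ℕ) [Fact p.Prime] (hs : 2 ≤ s)
    (hq : q = p ^ s)
    (P : Polynomial (AlgebraicClosure (ZMod p)))
    (hPq : ∀ i, P.coeff i ^ q = P.coeff i)
    (hP2 : 2 ≤ P.natDegree) (hP3 : P.natDegree ≤ q / p - 1) :
    ¬ ∃ (M : GL (Fin 3) (AlgebraicClosure (ZMod p)))
        (c : (AlgebraicClosure (ZMod p))ˣ),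
      ∀ v : Fin 3 → AlgebraicClosure (ZMod p),
        (M : Matrix (Fin 3) (Fin 3) (AlgebraicClosure (ZMod p))).mulVec
            ![v 0 ^ q,
              v 1 ^ q + v 2 ^ (q - p - 1) * v 0 * v 1 ^ p + v 2 ^ (q - 2) * (v 0 - v 2) * v 1,
              v 2 ^ q] =
          (c : AlgebraicClosure (ZMod p)) •
            ![((M : Matrix (Fin 3) (Fin 3) (AlgebraicClosure (ZMod p))).mulVec v 0) ^ q,
              ((M : Matrix (Fin 3) (Fin 3) (AlgebraicClosure (ZMod p))).mulVec v 1) ^ q +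
                ∑ m ∈ (sectionSevenGs p P).support,
                  coeff m (sectionSevenGs p P) *
                    ((M : Matrix (Fin 3) (Fin 3) (AlgebraicClosure (ZMod p))).mulVec v 0) ^ (m 0) *
                    ((M : Matrix (Fin 3) (Fin 3) (AlgebraicClosure (ZMod p))).mulVec v 1) ^ (m 1) *
                    ((M : Matrix (Fin 3) (Fin 3) (AlgebraicClosure (ZMod p))).mulVec v 2) ^
                      (q - m 0 - m 1),
              ((M : Matrix (Fin 3) (Fin 3) (AlgebraicClosure (ZMod p))).mulVec v 2) ^ q] := by
  have hp : p.Prime := Fact.out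
  have hp2 := hp.two_le
  have hpd : p * P.natDegree + p ≤ q := by
    have h1 : P.natDegree + 1 ≤ q / p := by omega
    calc p * P.natDegree + p = p * (P.natDegree + 1) := by ring
      _ ≤ p * (q / p) := Nat.mul_le_mul_left p h1
      _ ≤ q := Nat.mul_div_le q p
  have hm : 2 ≤ q - p - 1 ∧ p < q := by
    have : p * 2 ≤ p * P.natDegree := Nat.mul_le_mul_left p hP2
    omega
  obtain ⟨hm, hpq⟩ := hm
  rintro ⟨M, c, h⟩
  have hG := fun x y z (hz : z ≠ 0) => sum_homogenize_eq (sectionSevenGs p P) (q := q)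
    ((totalDegree_sectionSevenGs_le p P (by omega)).trans (by omega)) x y hz
  simp only [eval_sectionSevenGs] at hG
  have hdet : (M : Matrix (Fin 3) (Fin 3) (AlgebraicClosure (ZMod p))).det ≠ 0 :=
    ((Matrix.isUnit_iff_isUnit_det _).mp M.isUnit).ne_zero
  have hc : (c : AlgebraicClosure (ZMod p)) ≠ 0 := c.ne_zero
  generalize (c : AlgebraicClosure (ZMod p)) = c at h hc
  generalize (M : Matrix (Fin 3) (Fin 3) (AlgebraicClosure (ZMod p))) = M at h hdet
  have h0 := fun x y z => congrFun (h ![x, y, z]) 0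
  have h1 := fun x y z => congrFun (h ![x, y, z]) 1
  have h2 := fun x y z => congrFun (h ![x, y, z]) 2
  clear h
  simp only [Matrix.mulVec, dotProduct, Fin.sum_univ_three, Matrix.cons_val_zero,
    Matrix.cons_val_one, Matrix.cons_val, Pi.smul_apply, smul_eq_mul] at h0 h1 h2
  have h01 := entry_eq_zero_of_row hq hpq h0
  have h21 := entry_eq_zero_of_row hq hpq h2
  clear h0 h2
  rw [Matrix.det_fin_three] at hdet
  generalize M 0 0 = a at *
  generalize M 0 1 = a1 at *
  generalize M 0 2 = a2 at *
  generalize M 1 0 = e at *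
  generalize M 1 1 = u at *
  generalize M 1 2 = f at *
  generalize M 2 0 = b0 at *
  generalize M 2 1 = b1 at *
  generalize M 2 2 = b at *
  subst h01 h21
  have hu : u ≠ 0 := by rintro rfl; simp at hdet
  have hdet2 : a * b - a2 * b0 ≠ 0 := fun h => hdet (by linear_combination u * h)
  have key : ∀ x z, b0 * x + b * z ≠ 0 →
      u * (z ^ (q - p - 1) * x) =
        c * ((b0 * x + b * z) ^ (q - p - 1) * (a * x + a2 * z) * u ^ p) ∧
      z ^ (q - 2) * (x - z) = c * ((b0 * x + b * z) ^ (q - 2) *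
        (a * x + a2 * z - (b0 * x + b * z))) ∧
      e * x ^ q + f * z ^ q = c * ((e * x + f * z) ^ q + (b0 * x + b * z) ^ q *
        ((a * x + a2 * z) / (b0 * x + b * z) * ((e * x + f * z) / (b0 * x + b * z) +
          P.eval ((a * x + a2 * z) / (b0 * x + b * z))) ^ p +
        ((a * x + a2 * z) / (b0 * x + b * z) - 1) * ((e * x + f * z) / (b0 * x + b * z) +
          P.eval ((a * x + a2 * z) / (b0 * x + b * z))))) := by
    intro x z hz
    have hrow := fun y => h1 x y z
    simp only [zero_mul, add_zero] at hrow
    simp only [hG _ _ _ hz] at hrow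
    set Z := b0 * x + b * z with hZ
    set X0 := a * x + a2 * z with hX0
    set w := P.eval (X0 / Z) with hw
    have hZ1 : Z ^ (q - p - 1) * X0 = Z ^ q * (X0 / Z) / Z ^ p := by
      obtain ⟨r, hr⟩ : ∃ r, q = r + p + 1 := ⟨q - p - 1, by omega⟩
      have : q - p - 1 = r := by omega
      rw [this, hr]
      field_simp
      ring
    have hZ2 : Z ^ (q - 2) * (X0 - Z) = Z ^ q * (X0 / Z - 1) / Z := by
      obtain ⟨r, hr⟩ : ∃ r, q = r + 2 := ⟨q - 2, by omega⟩
      have : q - 2 = r := by omega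
      rw [this, hr]
      field_simp
      ring
    obtain ⟨hB, hC, hD⟩ := coeffs_eq_zero_of_forall_eval hp.one_lt hpq
      (a := u - c * u ^ q)
      (b := u * (z ^ (q - p - 1) * x) - c * (Z ^ (q - p - 1) * X0 * u ^ p))
      (c := u * (z ^ (q - 2) * (x - z) - c * (Z ^ (q - 2) * (X0 - Z))))
      (d := e * x ^ q + f * z ^ q - c * ((e * x + f * z) ^ q + Z ^ q *
        (X0 / Z * ((e * x + f * z) / Z + w) ^ p + (X0 / Z - 1) * ((e * x + f * z) / Z + w))))
      (fun y => by
        have hy := hrow y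
        have e1 : e * x + u * y + f * z = u * y + (e * x + f * z) := by ring
        have e2 : (u * y + (e * x + f * z)) ^ q = (u * y) ^ q + (e * x + f * z) ^ q := by
          rw [hq, add_pow_char_pow]
        have e3 : (u * y + (e * x + f * z)) / Z + w =
            u * y / Z + ((e * x + f * z) / Z + w) := by ring
        rw [e1, e2, e3, add_pow_char (u * y / Z), mul_pow, div_pow, mul_pow] at hy
        rw [hZ1, hZ2]
        linear_combination hy)
    exact ⟨sub_eq_zero.mp hB, sub_eq_zero.mp ((mul_eq_zero.mp hC).resolve_left hu),
      sub_eq_zero.mp hD⟩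
  have hb0 : b0 = 0 := by
    by_contra hb0
    have ha : a = 0 := by
      have := (key 1 0 (by simpa using hb0)).1
      simpa [hc, hb0, hu, show q - p - 1 ≠ 0 by omega] using this
    subst ha
    have ha2 : a2 ≠ 0 := by rintro rfl; simp at hdet2
    have hb : b = 0 := by
      by_contra hb
      have := (key 0 1 (by simpa using hb)).1
      simp [hc, hb, hu, ha2] at this
    subst hb
    obtain ⟨r, hr, hr0⟩ : ∃ r, q - p - 1 = r + 1 ∧ 0 < r := ⟨q - p - 1 - 1, by omega, by omega⟩
    obtain ⟨x, hx, hxr⟩ := exists_ne_zero_pow_ne_one (K := AlgebraicClosure (ZMod p)) hr0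
    have k1 := (key 1 1 (by simpa using hb0)).1
    have k2 := (key x 1 (by simpa using ⟨hb0, hx⟩)).1
    simp only [hr, one_pow, one_mul, mul_one, zero_mul, add_zero, zero_add, mul_pow] at k1 k2
    have h3 : u * x * (x ^ r - 1) = 0 := by linear_combination x * x ^ r * k1 - k2
    rcases mul_eq_zero.mp h3 with h4 | h4
    · exact mul_ne_zero hu hx h4
    · exact hxr (sub_eq_zero.mp h4)
  subst hb0
  have hb : b ≠ 0 := by rintro rfl; simp at hdet2
  have ha2 : a2 = 0 := by
    have := (key 0 1 (by simpa using hb)).1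
    simpa [hc, hb, hu] using this
  subst ha2
  simp only [zero_mul, zero_add, add_zero] at key
  have hab : a = b := by
    have := (key 1 1 (by simpa using hb)).2.1
    simpa [hc, hb, sub_eq_zero] using this
  subst hab
  refine not_forall_eq_pow_add_const (q := q) hp.one_lt P hP2 (by omega) (e / a) (f / a)
    ((e / c - e ^ q) / a ^ q) ((f / c - f ^ q) / a ^ q) fun x => ?_
  have hD := (key x 1 (by simpa using hb)).2.2
  have hfrob : (e * x + f) ^ q = e ^ q * x ^ q + f ^ q := by
    rw [hq, add_pow_char_pow, mul_pow]
  have hx : a * x / a = x := by field_simp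
  have hef : (e * x + f) / a = e / a * x + f / a := by ring
  simp only [mul_one, one_pow, hfrob, hx, hef] at hD
  generalize e / a * x + f / a + P.eval x = w at hD ⊢
  field_simp at hD ⊢
  linear_combination -hD
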